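/- Let a discrete many-to-one matching market be given. If the firm-worker hypergraph of the market has no nontrivial odd-length cycle with the following property — for each firm f and each pair of sets S, S′ such that both {f} ∪ S and {f} ∪ S′ are edges of the cycle, either S = Ch_f(S ∪ S′) or S′ = Ch_f(S ∪ S′) — then a stable matching exists. -/

import Mathlib

open Finset


/-- A cycle of length `k` in a hypergraph with edge predicate `edges`:
a cyclic alternating sequence of `k` distinct vertices `j 0, …, j (k-1)` and
`k` distinct edges `E 0, …, E (k-1)` with `j i ∈ E i` and `j (i+1) ∈ E i`
(indices modulo `k`), where `k ≥ 2`. -/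
def IsCycle {V : Type*} (edges : Finset V → Prop) (k : ℕ)
    (j : ZMod k → V) (E : ZMod k → Finset V) : Prop :=
  2 ≤ k ∧ Function.Injective j ∧ Function.Injective E ∧
    (∀ i, edges (E i)) ∧ (∀ i, j i ∈ E i ∧ j (i + 1) ∈ E i)

/-- A nontrivial odd-length cycle: a cycle of odd length such that every edge `E i`
of the cycle contains exactly two of the cycle's vertices; since `j i` and `j (i+1)`
are two distinct cycle vertices belonging to `E i`, this says that the only cycle
vertices in `E i` are `j i` and `j (i+1)`. -/
def IsNontrivialOddCycle {V : Type*} (edges : Finset V → Prop) (k : ℕ)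
    (j : ZMod k → V) (E : ZMod k → Finset V) : Prop :=
  IsCycle edges k j E ∧ Odd k ∧ ∀ i t : ZMod k, j t ∈ E i → t = i ∨ t = i + 1

/-- The hypergraph with edge predicate `edges` has some nontrivial odd-length cycle. -/
def HasNontrivialOddCycle {V : Type*} (edges : Finset V → Prop) : Prop :=
  ∃ (k : ℕ) (j : ZMod k → V) (E : ZMod k → Finset V),
    IsNontrivialOddCycle edges k j E

/-- The set of workers assigned to firm `f` by the assignment `μ`. -/
def assignedSet {F W : Type*} [Fintype W] [DecidableEq F] (μ : W → Option F) (f : F) :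
    Finset W :=
  Finset.univ.filter fun w => μ w = some f

/-- A discrete many-to-one matching market: firms `F`, workers `W`; each worker `w`
has a strict (total) preference `pw w` over `Option F` (`none` = unmatched); each firm
`f` has a strict (total) preference `pf f` over subsets of `W`; `Ch f S` is the
`pf f`-maximal subset of `S`. Here `pw w a b` (resp. `pf f A B`) means `a ≻_w b`
(resp. `A ≻_f B`). -/
structure DMarket (F W : Type*) [Fintype W] [DecidableEq F] [DecidableEq W] where
  pw : W → Option F → Option F → Prop
  pw_sto : ∀ w, IsStrictTotalOrder (Option F) (pw w)
  pf : F → Finset W → Finset W → Prop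
  pf_sto : ∀ f, IsStrictTotalOrder (Finset W) (pf f)
  Ch : F → Finset W → Finset W
  Ch_subset : ∀ f S, Ch f S ⊆ S
  Ch_max : ∀ f S S', S' ⊆ S → S' ≠ Ch f S → pf f (Ch f S) S'

namespace DMarket

variable {F W : Type*} [Fintype W] [DecidableEq F] [DecidableEq W]

/-- `S` is satisfactory to firm `f`: `S` is nonempty and `Ch f S = S`. -/
def Satisf (M : DMarket F W) (f : F) (S : Finset W) : Prop :=
  S.Nonempty ∧ M.Ch f S = S

/-- Individual rationality of a matching `μ`: every worker weakly prefers her match to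
being unmatched, and every firm chooses its whole assigned set. -/
def IndivRat (M : DMarket F W) (μ : W → Option F) : Prop :=
  (∀ w, μ w = none ∨ M.pw w (μ w) none) ∧
  (∀ f, M.Ch f (assignedSet μ f) = assignedSet μ f)

/-- `(f, S)` is a blocking coalition for `μ`: every worker in `S` weakly prefers `f` to
her current match, and `f` strictly prefers `S` to its current assigned set. -/
def Blocks (M : DMarket F W) (μ : W → Option F) (f : F) (S : Finset W) : Prop :=
  (∀ w ∈ S, μ w = some f ∨ M.pw w (some f) (μ w)) ∧ M.pf f S (assignedSet μ f)

/-- Stability of a matching `μ` in a discrete matching market. -/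
def Stable (M : DMarket F W) (μ : W → Option F) : Prop :=
  M.IndivRat μ ∧ ¬ ∃ f S, M.Blocks μ f S

/-- The firm-worker hypergraph of a discrete market: vertices `F ⊕ W`, and an edge
`{f} ∪ S` for each firm `f` and each satisfactory set `S` of `f`. -/
def fwEdges (M : DMarket F W) (e : Finset (F ⊕ W)) : Prop :=
  ∃ f S, M.Satisf f S ∧ e = insert (Sum.inl f) (S.image Sum.inr)

end DMarket

/-- The property of a cycle (given by its edges `E`) that for each firm `f` and each pair
`S, S'` such that both `{f} ∪ S` and `{f} ∪ S'` are edges of the cycle, either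
`S = Ch f (S ∪ S')` or `S' = Ch f (S ∪ S')`. -/
def DMarket.ChPropCycle {F W : Type*} [Fintype W] [DecidableEq F] [DecidableEq W]
    (M : DMarket F W) {k : ℕ} (E : ZMod k → Finset (F ⊕ W)) : Prop :=
  ∀ (f : F) (S S' : Finset W),
    (∃ i, E i = insert (Sum.inl f) (S.image Sum.inr)) →
    (∃ i, E i = insert (Sum.inl f) (S'.image Sum.inr)) →
    M.Ch f (S ∪ S') = S ∨ M.Ch f (S ∪ S') = S'

/-- `D` dominates every column: no column is strictly above all the row minima of `D`. -/
def IsDominating {ι κ α : Type*} [LinearOrder α] (c : ι → κ → α) (D : Finset κ) : Prop :=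
  ∀ e, ∃ i, ∀ d ∈ D, c i e ≤ c i d

/-- In a dominating set with as many columns as there are rows, taking row minima is a
bijection. -/
theorem IsDominating.exists_rowMin {ι κ α : Type*} [Fintype ι] [LinearOrder α]
    {c : ι → κ → α} (hc : ∀ i, Function.Injective (c i)) {D : Finset κ}
    (hD : IsDominating c D) (hcard : #D = Fintype.card ι) :
    ∃ g : ι → κ, Function.Injective g ∧ (∀ i, g i ∈ D) ∧ (∀ i, ∀ d ∈ D, c i (g i) ≤ c i d) ∧
      ∀ d ∈ D, ∃ i, g i = d := by
  classical
  have hmin : ∀ i : ι, ∃ d ∈ D, ∀ d' ∈ D, c i d ≤ c i d' := fun i => by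
    have : D.Nonempty := by
      rw [← card_pos, hcard]
      exact Fintype.card_pos_iff.2 ⟨i⟩
    exact exists_min_image D (c i) this
  choose g hgD hgmin using hmin
  have hsurj : ∀ d ∈ D, ∃ i, g i = d := fun d hd => by
    obtain ⟨i, hi⟩ := hD d
    exact ⟨i, hc i (le_antisymm (hgmin i d hd) (hi _ (hgD i)))⟩
  refine ⟨g, ?_, hgD, hgmin, hsurj⟩
  have himg : univ.image g = D := by
    ext d
    constructor
    · intro h
      obtain ⟨i, -, rfl⟩ := mem_image.1 h
      exact hgD i
    · intro h
      obtain ⟨i, rfl⟩ := hsurj d h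
      exact mem_image_of_mem g (mem_univ i)
  have := card_image_iff.1 (show #(univ.image g) = #(univ : Finset ι) by
    rw [himg, hcard, card_univ])
  exact fun a b hab => this (by simp) (by simp) hab

/-- Ordinal pivoting, generic case: a set with one column too few that contains a non-slack
column extends to a dominating set in zero or two ways. -/
theorem even_card_dominating_extensions {ι κ α : Type*} [Fintype ι] [Fintype κ] [DecidableEq κ]
    [LinearOrder α] {c : ι → κ → α} (hc : ∀ i, Function.Injective (c i)) {s : ι → κ}
    {R : Finset κ} {d₀ : κ} (hd₀ : d₀ ∈ R) (hs : ∀ i j, i ≠ j → c i d₀ < c i (s j))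
    {𝒪 : Finset (Finset κ)}
    (h𝒪 : ∀ D, D ∈ 𝒪 ↔ #D = Fintype.card ι ∧ IsDominating c D)
    (hR : #R + 1 = Fintype.card ι) : Even #{D ∈ 𝒪 | R ⊆ D} := by
  classical
  have hext : ∀ D ∈ 𝒪, R ⊆ D → ∃ e ∉ R, insert e R = D := fun D hD hRD => by
    have h1 : #(D \ R) = 1 := by
      rw [card_sdiff_of_subset hRD, ((h𝒪 D).1 hD).1]; omega
    obtain ⟨e, he⟩ := card_eq_one.1 h1
    have : e ∈ D \ R := by simp [he]
    refine ⟨e, (mem_sdiff.1 this).2, ?_⟩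
    rw [insert_eq, ← he, sdiff_union_of_subset hRD]
  rcases Finset.eq_empty_or_nonempty {D ∈ 𝒪 | R ⊆ D} with h0 | ⟨D₀, hD₀⟩
  · simp [h0]
  obtain ⟨hD₀𝒪, hRD₀⟩ := mem_filter.1 hD₀
  obtain ⟨e₀, he₀, rfl⟩ := hext D₀ hD₀𝒪 hRD₀
  obtain ⟨hcard₀, hdom₀⟩ := (h𝒪 _).1 hD₀𝒪
  obtain ⟨g, hginj, hgD, hgmin, hgsurj⟩ := hdom₀.exists_rowMin hc hcard₀
  have hmin : ∀ i, ∃ d ∈ R, ∀ d' ∈ R, c i d ≤ c i d' := fun i =>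
    exists_min_image R (c i) ⟨d₀, hd₀⟩
  choose m hmR hmmin using hmin
  obtain ⟨p, hp⟩ := hgsurj e₀ (mem_insert_self _ _)
  have hgR : ∀ i, i ≠ p → g i ∈ R := fun i hi =>
    (mem_insert.1 (hgD i)).resolve_left fun h => hi (hginj (h.trans hp.symm))
  have hgm : ∀ i, i ≠ p → g i = m i := fun i hi =>
    hc i (le_antisymm (hgmin i _ (mem_insert_of_mem (hmR i))) (hmmin i _ (hgR i hi)))
  obtain ⟨q, hq⟩ := hgsurj (m p) (mem_insert_of_mem (hmR p))
  have hqp : q ≠ p := by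
    rintro rfl
    exact he₀ (hp ▸ hq ▸ hmR q)
  have hmq : m q = m p := (hgm q hqp).symm.trans hq
  have hcol : ∀ i j, i ≠ j → m i = m j → i = p ∧ j = q ∨ i = q ∧ j = p := by
    intro i j hij hm
    by_cases hi : i = p
    · left
      refine ⟨hi, hginj ?_⟩
      rw [hgm j (fun h => hij (hi.trans h.symm)), ← hm, hi, hq]
    · by_cases hj : j = p
      · right
        refine ⟨hginj ?_, hj⟩
        rw [hgm i hi, hm, hj, hq]
      · exact absurd (hginj (by rw [hgm i hi, hgm j hj, hm])) hij
  have hmsurj : ∀ d ∈ R, ∃ i, i ≠ q ∧ m i = d := by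
    intro d hd
    obtain ⟨i, rfl⟩ := hgsurj d (mem_insert_of_mem hd)
    have hip : i ≠ p := by rintro rfl; exact he₀ (hp ▸ hd)
    by_cases hiq : i = q
    · exact ⟨p, hqp.symm, by rw [hiq, hq]⟩
    · exact ⟨i, hiq, (hgm i hip).symm⟩
  have hN : ∀ z, ∃ i, c i z ≤ c i (m i) := fun z => by
    obtain ⟨i, hi⟩ := hdom₀ z
    exact ⟨i, hi _ (mem_insert_of_mem (hmR i))⟩
  -- the row in which the added column is minimal determines that column
  have hchar : ∀ e ∉ R, insert e R ∈ 𝒪 → ∃ r, (r = p ∨ r = q) ∧ (∀ i, i ≠ r → c i (m i) < c i e) ∧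
      ∀ z, (∀ i, i ≠ r → c i (m i) < c i z) → c r z ≤ c r e := by
    intro e he heO
    obtain ⟨hcard, hdom⟩ := (h𝒪 _).1 heO
    obtain ⟨k, hkinj, hkD, hkmin, hksurj⟩ := hdom.exists_rowMin hc hcard
    obtain ⟨r, hr⟩ := hksurj e (mem_insert_self _ _)
    have hkR : ∀ i, i ≠ r → k i ∈ R := fun i hi =>
      (mem_insert.1 (hkD i)).resolve_left fun h => hi (hkinj (h.trans hr.symm))
    have hkm : ∀ i, i ≠ r → k i = m i := fun i hi =>
      hc i (le_antisymm (hkmin i _ (mem_insert_of_mem (hmR i))) (hmmin i _ (hkR i hi)))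
    refine ⟨r, ?_, ?_, ?_⟩
    · obtain ⟨r', hr'⟩ := hksurj (m r) (mem_insert_of_mem (hmR r))
      have hne : r' ≠ r := by
        rintro rfl
        exact he (hr ▸ hr' ▸ hmR r')
      rcases hcol r' r hne ((hkm r' hne).symm.trans hr') with h | h
      · exact Or.inr h.2
      · exact Or.inl h.2
    · intro i hi
      rw [← hkm i hi]
      refine lt_of_le_of_ne (hkmin i e (mem_insert_self _ _)) fun h => ?_
      exact he (hc i h ▸ hkR i hi)
    · intro z hz
      obtain ⟨i, hi⟩ := hdom z
      by_cases hir : i = r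
      · subst hir; exact hi e (mem_insert_self _ _)
      · exact absurd (hi _ (mem_insert_of_mem (hmR i))) (not_le.2 (hz i hir))
  have huniq : ∀ r e e', (∀ i, i ≠ r → c i (m i) < c i e) →
      (∀ z, (∀ i, i ≠ r → c i (m i) < c i z) → c r z ≤ c r e) →
      (∀ i, i ≠ r → c i (m i) < c i e') →
      (∀ z, (∀ i, i ≠ r → c i (m i) < c i z) → c r z ≤ c r e') → e = e' :=
    fun r e e' h1 h2 h3 h4 => hc r (le_antisymm (h4 _ h1) (h2 _ h3))
  have hp₀ : c p e₀ ≤ c p (m p) := by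
    have := hgmin p _ (mem_insert_of_mem (hmR p))
    rwa [hp] at this
  obtain ⟨r₀, hr₀, hr₀1, hr₀2⟩ := hchar e₀ he₀ hD₀𝒪
  have hr₀p : r₀ = p := by
    by_contra h
    exact absurd (hr₀1 p (Ne.symm h)) (not_lt.2 hp₀)
  subst hr₀p
  obtain ⟨e₁, he₁M, he₁max⟩ := exists_max_image
    (univ.filter fun z => ∀ i, i ≠ q → c i (m i) < c i z) (c q)
    ⟨s q, by
      rw [mem_filter]
      exact ⟨mem_univ _, fun i hi => (hmmin i _ hd₀).trans_lt (hs i q hi)⟩⟩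
  replace he₁M := (mem_filter.1 he₁M).2
  replace he₁max : ∀ z, (∀ i, i ≠ q → c i (m i) < c i z) → c q z ≤ c q e₁ :=
    fun z hz => he₁max z (mem_filter.2 ⟨mem_univ _, hz⟩)
  have he₁R : e₁ ∉ R := fun h => by
    obtain ⟨i, hi, hi'⟩ := hmsurj e₁ h
    exact absurd (he₁M i hi) (by rw [hi']; exact lt_irrefl _)
  have he₁O : insert e₁ R ∈ 𝒪 := by
    refine (h𝒪 _).2 ⟨by rw [card_insert_of_notMem he₁R, hR], fun z => ?_⟩
    by_cases hz : ∀ i, i ≠ q → c i (m i) < c i z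
    · refine ⟨q, fun d hd => ?_⟩
      rcases mem_insert.1 hd with rfl | hd
      · exact he₁max z hz
      · obtain ⟨i, hi⟩ := hN z
        have : i = q := by
          by_contra h
          exact absurd (hz i h) (not_lt.2 hi)
        subst this
        exact hi.trans (hmmin i d hd)
    · push Not at hz
      obtain ⟨i, hi, hz⟩ := hz
      refine ⟨i, fun d hd => ?_⟩
      rcases mem_insert.1 hd with rfl | hd
      · exact hz.trans (he₁M i hi).le
      · exact hz.trans (hmmin i d hd)
  have hne : e₀ ≠ e₁ := by
    rintro rfl
    exact absurd (he₁M r₀ hqp.symm) (not_lt.2 hp₀)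
  have hpair : {D ∈ 𝒪 | R ⊆ D} = {insert e₀ R, insert e₁ R} := by
    ext D
    simp only [mem_filter, mem_insert, mem_singleton]
    constructor
    · rintro ⟨hD, hRD⟩
      obtain ⟨e, he, rfl⟩ := hext D hD hRD
      obtain ⟨r, rfl | rfl, h1, h2⟩ := hchar e he hD
      · left; rw [huniq r e e₀ h1 h2 hr₀1 hr₀2]
      · right; rw [huniq r e e₁ h1 h2 he₁M he₁max]
    · rintro (rfl | rfl)
      · exact ⟨hD₀𝒪, subset_insert _ _⟩
      · exact ⟨he₁O, subset_insert _ _⟩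
  rw [hpair, card_pair]
  · exact even_two
  · intro h
    have : e₀ ∈ insert e₁ R := h ▸ mem_insert_self e₀ R
    rcases mem_insert.1 this with h | h
    · exact hne h
    · exact he₀ h

/-- Ordinal pivoting, boundary case: the slack columns without one of them extend to a
dominating set in exactly one way. -/
theorem card_dominating_extensions_slack {ι κ α : Type*} [Fintype ι] [DecidableEq ι] [Fintype κ]
    [DecidableEq κ] [LinearOrder α] {c : ι → κ → α} (hc : ∀ i, Function.Injective (c i))
    {s : ι → κ} (hsinj : Function.Injective s) (hbot : ∀ i e, c i (s i) ≤ c i e)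
    (htop : ∀ i j e, i ≠ j → e ∉ Set.range s → c i e < c i (s j))
    {𝒪 : Finset (Finset κ)}
    (h𝒪 : ∀ D, D ∈ 𝒪 ↔ #D = Fintype.card ι ∧ IsDominating c D) (i₀ : ι) :
    #{D ∈ 𝒪 | (univ.image s).erase (s i₀) ⊆ D} = 1 := by
  classical
  set R := (univ.image s).erase (s i₀) with hRdef
  have hR : #R + 1 = Fintype.card ι := by
    rw [hRdef, card_erase_add_one (by simp), card_image_of_injective _ hsinj, card_univ]
  have hmemR : ∀ z, z ∈ R ↔ ∃ j, j ≠ i₀ ∧ s j = z := by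
    intro z
    simp only [hRdef, mem_erase, mem_image, mem_univ, true_and]
    constructor
    · rintro ⟨h, j, rfl⟩
      exact ⟨j, fun hj => h (by rw [hj]), rfl⟩
    · rintro ⟨j, hj, rfl⟩
      exact ⟨fun h => hj (hsinj h), j, rfl⟩
  have hdom : ∀ e ∉ R, insert e R ∈ 𝒪 ↔ ∀ z ∉ R, c i₀ z ≤ c i₀ e := by
    intro e he
    rw [h𝒪, card_insert_of_notMem he]
    constructor
    · rintro ⟨-, h⟩ z hz
      obtain ⟨i, hi⟩ := h z
      by_cases hii : i = i₀
      · subst hii; exact hi e (mem_insert_self _ _)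
      · have hsi : s i ∈ R := (hmemR _).2 ⟨i, hii, rfl⟩
        have : z = s i := hc i (le_antisymm (hi _ (mem_insert_of_mem hsi)) (hbot i z))
        exact absurd (this ▸ hsi) hz
    · refine fun h => ⟨hR, fun z => ?_⟩
      by_cases hz : z ∈ R
      · obtain ⟨j, -, rfl⟩ := (hmemR z).1 hz
        exact ⟨j, fun d _ => hbot j d⟩
      · refine ⟨i₀, fun d hd => ?_⟩
        rcases mem_insert.1 hd with rfl | hd
        · exact h z hz
        · obtain ⟨j, hj, rfl⟩ := (hmemR d).1 hd
          by_cases hzs : z ∈ Set.range s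
          · obtain ⟨k, rfl⟩ := hzs
            have : k = i₀ := by
              by_contra hk
              exact hz ((hmemR _).2 ⟨k, hk, rfl⟩)
            subst this
            exact hbot _ _
          · exact (htop i₀ j z hj.symm hzs).le
  have hs₀ : s i₀ ∉ R := by simp [hRdef]
  obtain ⟨e, heR, hemax⟩ := exists_max_image (univ \ R) (c i₀) ⟨s i₀, by simp [hs₀]⟩
  replace heR : e ∉ R := (mem_sdiff.1 heR).2
  replace hemax : ∀ z ∉ R, c i₀ z ≤ c i₀ e := fun z hz => hemax z (by simp [hz])
  rw [card_eq_one]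
  refine ⟨insert e R, ?_⟩
  ext D
  simp only [mem_filter, mem_singleton]
  constructor
  · rintro ⟨hD, hRD⟩
    have h1 : #(D \ R) = 1 := by
      rw [card_sdiff_of_subset hRD, ((h𝒪 D).1 hD).1]; omega
    obtain ⟨e', he'⟩ := card_eq_one.1 h1
    have he'R : e' ∉ R := (mem_sdiff.1 (show e' ∈ D \ R by simp [he'])).2
    have hD' : insert e' R = D := by
      rw [insert_eq, ← he', sdiff_union_of_subset hRD]
    subst hD'
    rw [hc i₀ (le_antisymm (hemax e' he'R) ((hdom e' he'R).1 hD e heR))]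
  · rintro rfl
    exact ⟨(hdom e heR).2 hemax, subset_insert _ _⟩

/-- The parity argument behind complementary pivoting. -/
theorem exists_mem_both_of_parity {κ : Type*} [DecidableEq κ] {𝒪 𝓕 : Finset (Finset κ)} {n : ℕ}
    (h𝒪n : ∀ D ∈ 𝒪, #D = n) (h𝓕n : ∀ C ∈ 𝓕, #C = n) (s : κ)
    (h𝓕 : ∀ D ∈ 𝒪, s ∉ D → Even #{C ∈ 𝓕 | C ⊆ insert s D})
    {C₀ : Finset κ} (hC₀ : C₀ ∈ 𝓕) (hsC₀ : s ∈ C₀) (hodd : Odd #{D ∈ 𝒪 | C₀.erase s ⊆ D})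
    (h𝒪 : ∀ C ∈ 𝓕, s ∈ C → C ≠ C₀ → Even #{D ∈ 𝒪 | C.erase s ⊆ D}) :
    ∃ D ∈ 𝒪, D ∈ 𝓕 := by
  classical
  by_contra! hno
  have key := sum_card_bipartiteAbove_eq_sum_card_bipartiteBelow (s := 𝓕) (t := 𝒪)
    (fun C D : Finset κ => s ∈ C ∧ C.erase s ⊆ D)
  have heq : ∀ C ∈ 𝓕, ∀ D ∈ 𝒪, C ⊆ D → False := fun C hC D hD hCD => by
    have := eq_of_subset_of_card_le hCD (by rw [h𝒪n D hD, h𝓕n C hC])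
    exact hno D hD (this ▸ hC)
  have hright : Even (∑ D ∈ 𝒪, #(bipartiteBelow (fun C D : Finset κ => s ∈ C ∧ C.erase s ⊆ D) 𝓕 D)) := by
    refine even_sum _ fun D hD => ?_
    by_cases hsD : s ∈ D
    · convert Even.zero (α := ℕ)
      rw [card_eq_zero, bipartiteBelow, filter_eq_empty_iff]
      rintro C hC ⟨hsC, hCD⟩
      refine heq C hC D hD ?_
      rw [← insert_erase hsC]
      exact insert_subset hsD hCD
    · rw [bipartiteBelow, filter_congr (q := fun C => C ⊆ insert s D)]
      · exact h𝓕 D hD hsD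
      intro C hC
      constructor
      · rintro ⟨-, h⟩
        exact subset_insert_iff.2 h
      · intro h
        refine ⟨?_, subset_insert_iff.1 h⟩
        by_contra hsC
        exact heq C hC D hD ((subset_insert_iff_of_notMem hsC).1 h)
  have hleft : Odd (∑ C ∈ 𝓕, #(bipartiteAbove (fun C D : Finset κ => s ∈ C ∧ C.erase s ⊆ D) 𝒪 C)) := by
    rw [← add_sum_erase _ _ hC₀]
    refine Odd.add_even ?_ (even_sum _ fun C hC => ?_)
    · simpa [bipartiteAbove, hsC₀] using hodd
    · obtain ⟨hne, hC⟩ := mem_erase.1 hC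
      by_cases hsC : s ∈ C
      · simpa [bipartiteAbove, hsC] using h𝒪 C hC hsC hne
      · simp [bipartiteAbove, hsC]
  rw [key] at hleft
  exact (Nat.not_even_iff_odd.2 hleft) hright

/-- `b` is a nonnegative combination of the columns of `a` in `C`. -/
def IsFeasibleOn {ι κ : Type*} [Fintype κ] (a : κ → ι → ℚ) (b : ι → ℚ) (C : Finset κ) : Prop :=
  ∃ x : κ → ℚ, (∀ k, 0 ≤ x k) ∧ (∀ k ∉ C, x k = 0) ∧ ∑ k, x k • a k = b

/-- `b` is not a combination of fewer columns of `a` than there are rows. -/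
def IsGenericFor {ι κ : Type*} [Fintype ι] [Fintype κ] (a : κ → ι → ℚ) (b : ι → ℚ) : Prop :=
  ∀ (T : Finset κ) (w : κ → ℚ), (∀ k ∉ T, w k = 0) → ∑ k, w k • a k = b → Fintype.card ι ≤ #T

theorem exists_relation_of_card_lt {ι κ : Type*} [Fintype ι] [Fintype κ] (a : κ → ι → ℚ)
    {T : Finset κ} (hT : Fintype.card ι < #T) :
    ∃ z : κ → ℚ, (∀ k ∉ T, z k = 0) ∧ ∑ k, z k • a k = 0 ∧ ∃ k, z k ≠ 0 := by
  classical
  have hdep : ¬ LinearIndependent ℚ (fun k : T => a k) := fun h => by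
    have := h.fintype_card_le_finrank
    simp at this
    omega
  obtain ⟨g, hsum, k, hk⟩ := Fintype.not_linearIndependent_iff.1 hdep
  refine ⟨fun k => if h : k ∈ T then g ⟨k, h⟩ else 0, fun k hk => by simp [hk], ?_,
    k, by simpa using hk⟩
  rw [← hsum, ← sum_subset (subset_univ T), ← sum_coe_sort T]
  · exact sum_congr rfl fun k _ => by simp
  · intro k _ hk; simp [hk]

/-- Columns carrying a generic vector are independent. -/
theorem IsGenericFor.eq_zero_of_relation {ι κ : Type*} [Fintype ι] [Fintype κ]
    {a : κ → ι → ℚ} {b : ι → ℚ} (hb : IsGenericFor a b) {C : Finset κ}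
    (hC : #C = Fintype.card ι) {x : κ → ℚ} (hxC : ∀ k ∉ C, x k = 0)
    (hx : ∑ k, x k • a k = b) {z : κ → ℚ} (hzC : ∀ k ∉ C, z k = 0)
    (hz : ∑ k, z k • a k = 0) : z = 0 := by
  classical
  by_contra hne
  obtain ⟨l, hl⟩ := Function.ne_iff.1 hne
  simp only [Pi.zero_apply] at hl
  have hlC : l ∈ C := by
    by_contra h
    exact hl (hzC l h)
  have := hb (C.erase l) (fun k => x k - x l / z l * z k) (fun k hk => by
    by_cases hkl : k = l
    · subst hkl; field_simp; ring
    · have hkC : k ∉ C := fun h => hk (mem_erase.2 ⟨hkl, h⟩)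
      simp [hxC k hkC, hzC k hkC]) (by
    simp only [sub_smul, mul_smul, sum_sub_distrib, ← smul_sum, hz, hx, smul_zero, sub_zero])
  have h2 := card_erase_add_one hlC
  omega

/-- Cardinal pivoting: among the sets obtained by deleting a column from a set with one column
too many, zero or two are feasible. -/
theorem even_card_feasible_subsets {ι κ : Type*} [Fintype ι] [Fintype κ] [DecidableEq κ]
    {a : κ → ι → ℚ} (ha : ∀ k i, 0 ≤ a k i) (ha' : ∀ k, ∃ i, 0 < a k i) {b : ι → ℚ}
    (hb : IsGenericFor a b) {𝓕 : Finset (Finset κ)}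
    (h𝓕 : ∀ C, C ∈ 𝓕 ↔ #C = Fintype.card ι ∧ IsFeasibleOn a b C)
    {T : Finset κ} (hT : #T = Fintype.card ι + 1) : Even #{C ∈ 𝓕 | C ⊆ T} := by
  have hdel : ∀ C ∈ 𝓕, C ⊆ T → ∃ c ∈ T, T.erase c = C := fun C hC hCT => by
    have h1 : #(T \ C) = 1 := by
      rw [card_sdiff_of_subset hCT, ((h𝓕 C).1 hC).1]; omega
    obtain ⟨c, hc⟩ := card_eq_one.1 h1
    have : c ∈ T \ C := by simp [hc]
    refine ⟨c, (mem_sdiff.1 this).1, ?_⟩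
    rw [erase_eq, ← hc, Finset.sdiff_sdiff_eq_self hCT]
  rcases Finset.eq_empty_or_nonempty {C ∈ 𝓕 | C ⊆ T} with h0 | ⟨C₀, hC₀⟩
  · simp [h0]
  obtain ⟨hC₀𝓕, hC₀T⟩ := mem_filter.1 hC₀
  obtain ⟨c, hcT, rfl⟩ := hdel C₀ hC₀𝓕 hC₀T
  obtain ⟨hcard, x, hx0, hxC, hxb⟩ := (h𝓕 _).1 hC₀𝓕
  have hxc : x c = 0 := hxC c (by simp)
  have hxT : ∀ k ∉ T, x k = 0 := fun k hk => hxC k fun h => hk (mem_of_mem_erase h)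
  have hzero : ∀ y : κ → ℚ, (∀ k ∉ T, y k = 0) → ∑ k, y k • a k = b →
      ∀ k ∈ T, ∀ l ∈ T, y k = 0 → y l = 0 → k = l := by
    intro y hyT hyb k hk l hl hyk hyl
    by_contra hkl
    have := hb ((T.erase k).erase l) y (fun j hj => by
      by_cases hjl : j = l
      · rw [hjl, hyl]
      by_cases hjk : j = k
      · rw [hjk, hyk]
      exact hyT j fun h => hj (by simp [hjl, hjk, h])) hyb
    rw [card_erase_of_mem (by simp [Ne.symm hkl, hl]), card_erase_of_mem hk] at this
    have := card_pos.2 ⟨c, hcT⟩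
    have : 1 < #T := one_lt_card.2 ⟨k, hk, l, hl, hkl⟩
    omega
  have hxpos : ∀ k ∈ T, k ≠ c → 0 < x k := fun k hk hkc =>
    lt_of_le_of_ne (hx0 k) fun h => hkc (hzero x hxT hxb k hk c hcT h.symm hxc)
  have hker : ∀ y : κ → ℚ, (∀ k ∉ T, y k = 0) → ∑ k, y k • a k = 0 → y c = 0 → y = 0 :=
    fun y hyT hy hyc => hb.eq_zero_of_relation hcard hxC hxb (fun k hk => by
      by_cases hkc : k = c
      · rw [hkc, hyc]
      · exact hyT k fun h => hk (mem_erase.2 ⟨hkc, h⟩)) hy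
  obtain ⟨z, hzT, hz, hzc⟩ : ∃ z : κ → ℚ, (∀ k ∉ T, z k = 0) ∧ ∑ k, z k • a k = 0 ∧ z c = 1 := by
    obtain ⟨z, hzT, hz, k, hk⟩ := exists_relation_of_card_lt a (T := T) (by omega)
    have hzc : z c ≠ 0 := fun h => hk (by rw [hker z hzT hz h]; rfl)
    refine ⟨fun k => (z c)⁻¹ * z k, fun k hk => by simp [hzT k hk], ?_, inv_mul_cancel₀ hzc⟩
    simp only [mul_smul, ← smul_sum, hz, smul_zero]
  obtain ⟨k₀, hk₀⟩ : ∃ k, z k < 0 := by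
    by_contra! hnn
    obtain ⟨i, hi⟩ := ha' c
    have h1 : ∑ k, z k * a k i = 0 := by simpa using congrFun hz i
    have h2 := (sum_eq_zero_iff_of_nonneg fun k _ => mul_nonneg (hnn k) (ha k i)).1 h1 c (mem_univ c)
    rw [hzc, one_mul] at h2
    exact hi.ne' h2
  obtain ⟨l, hl, hlmin⟩ := exists_min_image (univ.filter fun k => z k < 0)
    (fun k => x k / (-z k)) ⟨k₀, by simp [hk₀]⟩
  replace hl : z l < 0 := (mem_filter.1 hl).2
  replace hlmin : ∀ k, z k < 0 → x l / (-z l) ≤ x k / (-z k) :=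
    fun k hk => hlmin k (by simp [hk])
  have hlT : l ∈ T := by
    by_contra h
    rw [hzT l h] at hl
    exact lt_irrefl _ hl
  have hlc : l ≠ c := by
    rintro rfl
    rw [hzc] at hl
    linarith
  set t := x l / (-z l) with ht
  have ht0 : 0 ≤ t := div_nonneg (hx0 l) (by linarith)
  have htl : x l + t * z l = 0 := by
    rw [ht, div_neg, neg_mul, div_mul_cancel₀ _ hl.ne, add_neg_cancel]
  have hlF : T.erase l ∈ 𝓕 := by
    refine (h𝓕 _).2 ⟨by rw [card_erase_of_mem hlT, hT]; rfl, fun k => x k + t * z k, ?_, ?_, ?_⟩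
    · intro k
      by_cases hk : z k < 0
      · have := (le_div_iff₀ (by linarith : 0 < -z k)).1 (hlmin k hk)
        linarith
      · have := mul_nonneg ht0 (not_lt.1 hk)
        linarith [hx0 k]
    · intro k hk
      by_cases hkl : k = l
      · simpa only [hkl] using htl
      · have : k ∉ T := fun h => hk (mem_erase.2 ⟨hkl, h⟩)
        simp [hxT k this, hzT k this]
    · simp only [add_smul, mul_smul, sum_add_distrib, ← smul_sum, hz, hxb, smul_zero, add_zero]
  have hpair : {C ∈ 𝓕 | C ⊆ T} = {T.erase c, T.erase l} := by
    ext C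
    simp only [mem_filter, mem_insert, mem_singleton]
    constructor
    · rintro ⟨hC, hCT⟩
      obtain ⟨d, hdT, rfl⟩ := hdel C hC hCT
      by_cases hdc : d = c
      · exact Or.inl (by rw [hdc])
      right
      obtain ⟨-, y, hy0, hyC, hyb⟩ := (h𝓕 _).1 hC
      have hyT : ∀ k ∉ T, y k = 0 := fun k hk => hyC k fun h => hk (mem_of_mem_erase h)
      have hyd : y d = 0 := hyC d (by simp)
      have hline := hker (fun k => y k - x k - y c * z k)
        (fun k hk => by simp [hyT k hk, hxT k hk, hzT k hk])
        (by simp only [sub_smul, mul_smul, sum_sub_distrib, ← smul_sum, hz, hxb, hyb, smul_zero,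
          sub_self])
        (by simp [hxc, hzc])
      have hy : ∀ k, y k = x k + y c * z k := fun k => by
        have := congrFun hline k
        simp only [Pi.zero_apply] at this
        linarith
      have hzd : z d < 0 := by
        have h1 := hy d
        have h2 := hxpos d hdT hdc
        by_contra h
        have := mul_nonneg (hy0 c) (not_lt.1 h)
        linarith
      have h1 : t ≤ y c := by
        refine (hlmin d hzd).trans ?_
        rw [div_le_iff₀ (by linarith)]
        linarith [hy d]
      have h2 : y c ≤ t := by
        rw [ht, le_div_iff₀ (by linarith)]
        linarith [hy l, hy0 l]
      have hyl : y l = 0 := by rw [hy l, le_antisymm h2 h1, htl]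
      rw [hzero y hyT hyb d hdT l hlT hyd hyl]
    · rintro (rfl | rfl)
      · exact ⟨hC₀𝓕, erase_subset _ _⟩
      · exact ⟨hlF, erase_subset _ _⟩
  rw [hpair, card_pair]
  · exact even_two
  · intro h
    have : l ∈ T.erase c := mem_erase.2 ⟨hlc, hlT⟩
    rw [h] at this
    simp at this

open Filter Topology in
/-- Almost all points near `b` on a suitable line through `b` are generic. -/
theorem exists_direction_eventually_generic {ι κ : Type*} [Fintype ι] [Fintype κ]
    (a : κ → ι → ℚ) (b : ι → ℚ) :
    ∃ β : ι → ℚ, ∀ᶠ ε in 𝓝[>] (0 : ℚ), IsGenericFor a (b + ε • β) := by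
  classical
  let V : Finset κ → Submodule ℚ (ι → ℚ) := fun T => Submodule.span ℚ (T.image a)
  have hVtop : ∀ T : {T : Finset κ // #T < Fintype.card ι}, V T ≠ ⊤ := fun T h => by
    have h1 := finrank_span_finset_le_card (R := ℚ) (T.1.image a)
    have h2 : Module.finrank ℚ (V T) = Fintype.card ι := by
      rw [h, finrank_top, Module.finrank_fintype_fun_eq_card]
    have h3 := card_image_le (s := T.1) (f := a)
    have := T.2
    change Module.finrank ℚ (V T) ≤ _ at h1
    omega
  have hcov : ⋃ T : {T : Finset κ // #T < Fintype.card ι}, (V T : Set (ι → ℚ)) ≠ Set.univ := by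
    intro h
    obtain ⟨T, hT⟩ := Subspace.exists_eq_top_of_iUnion_eq_univ h
    exact hVtop T hT
  obtain ⟨β, hβ⟩ := (Set.ne_univ_iff_exists_notMem _).1 hcov
  simp only [Set.mem_iUnion, not_exists, SetLike.mem_coe] at hβ
  refine ⟨β, ?_⟩
  have hev : ∀ T : {T : Finset κ // #T < Fintype.card ι},
      ∀ᶠ ε in 𝓝[>] (0 : ℚ), b + ε • β ∉ V T := by
    intro T
    have hsub : {ε : ℚ | b + ε • β ∈ V T}.Subsingleton := by
      intro ε hε δ hδ
      by_contra hne
      have h := (V T).sub_mem hε hδ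
      rw [add_sub_add_left_eq_sub, ← sub_smul] at h
      exact hβ T ((Submodule.smul_mem_iff _ (sub_ne_zero.2 hne)).1 h)
    have h1 := hsub.finite.subset (Set.sdiff_subset (t := {0}))
    have h2 : ∀ᶠ ε in 𝓝 (0 : ℚ), ε ∉ {ε : ℚ | b + ε • β ∈ V T} \ {0} :=
      h1.isClosed.isOpen_compl.mem_nhds (by simp)
    filter_upwards [nhdsWithin_le_nhds h2, self_mem_nhdsWithin] with ε hε hpos h
    exact hε ⟨h, (ne_of_gt hpos : ε ≠ 0)⟩
  filter_upwards [eventually_all.2 hev] with ε hε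
  intro T w hwT hw
  by_contra! hlt
  refine hε ⟨T, hlt⟩ ?_
  rw [← hw]
  refine Submodule.sum_mem _ fun k _ => ?_
  by_cases hk : k ∈ T
  · exact Submodule.smul_mem _ _ (Submodule.subset_span (by simpa using ⟨k, hk, rfl⟩))
  · simp [hwT k hk]

open Filter Topology in
/-- Feasibility at generic points arbitrarily close to `b` on a line passes to `b`. -/
theorem isFeasibleOn_of_frequently {ι κ : Type*} [Fintype ι] [Fintype κ]
    {a : κ → ι → ℚ} {b β : ι → ℚ} {C : Finset κ} (hC : #C = Fintype.card ι)
    (h : ∃ᶠ ε in 𝓝[>] (0 : ℚ), IsGenericFor a (b + ε • β) ∧ IsFeasibleOn a (b + ε • β) C) :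
    IsFeasibleOn a b C := by
  obtain ⟨ε₁, ⟨hg₁, x₁, -, hx₁C, hx₁⟩, hε₁⟩ := (h.and_eventually self_mem_nhdsWithin).exists
  replace hε₁ : 0 < ε₁ := hε₁
  obtain ⟨ε₂, ⟨hg₂, x₂, -, hx₂C, hx₂⟩, hε₂⟩ :=
    (h.and_eventually (Ioo_mem_nhdsGT hε₁)).exists
  have hne : ε₁ - ε₂ ≠ 0 := sub_ne_zero.2 hε₂.2.ne'
  set q : κ → ℚ := fun k => (ε₁ - ε₂)⁻¹ * (x₁ k - x₂ k) with hq
  set p : κ → ℚ := fun k => x₁ k - ε₁ * q k with hp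
  have hqC : ∀ k ∉ C, q k = 0 := fun k hk => by simp [hq, hx₁C k hk, hx₂C k hk]
  have hpC : ∀ k ∉ C, p k = 0 := fun k hk => by simp [hp, hqC k hk, hx₁C k hk]
  have hqβ : ∑ k, q k • a k = β := by
    simp only [hq, mul_smul, sub_smul, sum_sub_distrib, ← smul_sum, hx₁, hx₂]
    rw [add_sub_add_left_eq_sub, ← sub_smul, inv_smul_smul₀ hne]
  have hpb : ∑ k, p k • a k = b := by
    simp only [hp, mul_smul, sub_smul, sum_sub_distrib, ← smul_sum, hx₁, hqβ, add_sub_cancel_right]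
  refine ⟨p, fun k => ?_, hpC, hpb⟩
  by_contra! hk
  have hev : ∀ᶠ ε in 𝓝[>] (0 : ℚ), p k + ε * q k < 0 := by
    have : Continuous fun ε : ℚ => p k + ε * q k := by fun_prop
    have h0 : Tendsto (fun ε : ℚ => p k + ε * q k) (𝓝 0) (𝓝 (p k)) := by
      simpa using this.tendsto 0
    exact nhdsWithin_le_nhds (h0.eventually_lt_const hk)
  obtain ⟨ε, ⟨hg, x, hx0, hxC, hx⟩, hε⟩ := (h.and_eventually hev).exists
  have := hg.eq_zero_of_relation hC hxC hx (z := fun k => x k - p k - ε * q k)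
    (fun k hk => by simp [hxC k hk, hpC k hk, hqC k hk])
    (by simp only [mul_smul, sub_smul, sum_sub_distrib, ← smul_sum, hx, hpb, hqβ,
          add_sub_cancel_left, sub_self])
  have h1 := congrFun this k
  simp only [Pi.zero_apply] at h1
  linarith [hx0 k]

/-- Scarf's lemma for a generic right-hand side. -/
theorem exists_dominating_feasible {ι κ α : Type*} [Fintype ι] [Nonempty ι] [Fintype κ]
    [LinearOrder α] {c : ι → κ → α} (hc : ∀ i, Function.Injective (c i))
    {s : ι → κ} (hsinj : Function.Injective s) (hbot : ∀ i e, c i (s i) ≤ c i e)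
    (htop : ∀ i j e, i ≠ j → e ∉ Set.range s → c i e < c i (s j))
    {a : κ → ι → ℚ} (ha : ∀ k i, 0 ≤ a k i) (ha' : ∀ k, ∃ i, 0 < a k i)
    (has : ∀ i (v : ι → ℚ), ∑ j, v j * a (s j) i = v i) {b : ι → ℚ} (hb0 : ∀ i, 0 ≤ b i)
    (hb : IsGenericFor a b) :
    ∃ D : Finset κ, #D = Fintype.card ι ∧ IsDominating c D ∧ IsFeasibleOn a b D := by
  classical
  obtain ⟨i₀⟩ := ‹Nonempty ι›
  set 𝒪 : Finset (Finset κ) := {D | #D = Fintype.card ι ∧ IsDominating c D} with h𝒪def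
  set 𝓕 : Finset (Finset κ) := {C | #C = Fintype.card ι ∧ IsFeasibleOn a b C} with h𝓕def
  have h𝒪 : ∀ D, D ∈ 𝒪 ↔ #D = Fintype.card ι ∧ IsDominating c D := by simp [h𝒪def]
  have h𝓕 : ∀ C, C ∈ 𝓕 ↔ #C = Fintype.card ι ∧ IsFeasibleOn a b C := by simp [h𝓕def]
  have hslack : univ.image s ∈ 𝓕 := by
    refine (h𝓕 _).2 ⟨by rw [card_image_of_injective _ hsinj, card_univ],
      fun k => ∑ i, if s i = k then b i else 0, fun k => ?_, fun k hk => ?_, ?_⟩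
    · exact sum_nonneg fun i _ => by split_ifs <;> simp [hb0 i]
    · refine sum_eq_zero fun i _ => if_neg ?_
      rintro rfl
      exact hk (mem_image_of_mem s (mem_univ i))
    · ext i
      simp only [Finset.sum_apply, Pi.smul_apply, smul_eq_mul, sum_mul, ite_mul, zero_mul]
      rw [sum_comm]
      simpa using has i b
  obtain ⟨D, hD𝒪, hD𝓕⟩ := exists_mem_both_of_parity (𝒪 := 𝒪) (𝓕 := 𝓕)
    (fun D hD => ((h𝒪 D).1 hD).1) (fun C hC => ((h𝓕 C).1 hC).1) (s i₀)
    (fun D hD hsD => even_card_feasible_subsets ha ha' hb h𝓕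
      (by rw [card_insert_of_notMem hsD, ((h𝒪 D).1 hD).1]))
    hslack (mem_image_of_mem s (mem_univ i₀))
    (by rw [card_dominating_extensions_slack hc hsinj hbot htop h𝒪 i₀]; exact odd_one)
    (fun C hC hsC hne => by
      have hcard := ((h𝓕 C).1 hC).1
      obtain ⟨d, hdC, hd⟩ : ∃ d ∈ C, d ∉ univ.image s := by
        by_contra! hsub
        exact hne (eq_of_subset_of_card_le hsub
          (by rw [hcard, ((h𝓕 _).1 hslack).1]))
      have hd' : d ∉ Set.range s := fun ⟨i, hi⟩ => hd (hi ▸ mem_image_of_mem s (mem_univ i))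
      refine even_card_dominating_extensions hc (d₀ := d) (s := s)
        (mem_erase.2 ⟨fun h => hd' ⟨i₀, h.symm⟩, hdC⟩) (fun i j hij => htop i j d hij hd') h𝒪 ?_
      rw [card_erase_add_one hsC, hcard])
  exact ⟨D, ((h𝒪 D).1 hD𝒪).1, ((h𝒪 D).1 hD𝒪).2, ((h𝓕 D).1 hD𝓕).2⟩

open Filter Topology in
/-- Scarf's lemma for hypergraphs: there is a fractional matching such that every edge `e` is
dominated at one of its vertices, which is saturated by edges at least as good as `e`. -/
theorem exists_dominating_fractional_matching {ι H α : Type*} [Fintype ι] [Fintype H]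
    [LinearOrder α] [Inhabited α] (inc : ι → H → Prop) [∀ i, DecidablePred (inc i)]
    (hinc : ∀ h, ∃ i, inc i h) (pref : ι → H → α) :
    ∃ x : H → ℚ, (∀ h, 0 ≤ x h) ∧ (∀ i, ∑ h with inc i h, x h ≤ 1) ∧
      ∀ e, ∃ i, inc i e ∧ ∑ h with inc i h, x h = 1 ∧
        ∀ h, inc i h → 0 < x h → pref i e ≤ pref i h := by
  classical
  rcases isEmpty_or_nonempty ι with hι | hι
  · exact ⟨0, fun _ => le_rfl, fun i => hι.elim i, fun e => hι.elim (hinc e).choose⟩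
  let rank : ι → ι ⊕ H → ℕ := fun i => Sum.elim (fun j => if j = i then 0 else 3)
    (fun h => if inc i h then 1 else 2)
  let score : ι → ι ⊕ H → α := fun i => Sum.elim (fun _ => default) (pref i)
  let c : ι → ι ⊕ H → ℕ ×ₗ α ×ₗ Fin (Fintype.card (ι ⊕ H)) := fun i k =>
    toLex (rank i k, toLex (score i k, Fintype.equivFin _ k))
  have hc : ∀ i, Function.Injective (c i) := fun i k l h => by
    have h2 := congrArg (fun p => (ofLex (ofLex p).2).2) h
    exact (Fintype.equivFin _).injective h2
  have hlt : ∀ i k l, rank i k < rank i l → c i k < c i l := fun i k l h =>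
    Prod.Lex.toLex_lt_toLex.2 (Or.inl h)
  have hle : ∀ i k l, c i k ≤ c i l →
      rank i k < rank i l ∨ rank i k = rank i l ∧ score i k ≤ score i l := by
    intro i k l h
    rcases Prod.Lex.toLex_le_toLex.1 h with h | ⟨h, h'⟩
    · exact Or.inl h
    · refine Or.inr ⟨h, ?_⟩
      rcases Prod.Lex.toLex_le_toLex.1 h' with h' | ⟨h', -⟩
      · exact h'.le
      · exact h'.le
  let a : ι ⊕ H → ι → ℚ := Sum.elim (fun j i => if j = i then 1 else 0)
    (fun h i => if inc i h then 1 else 0)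
  have ha : ∀ k i, 0 ≤ a k i := by
    rintro (j | h) i <;> simp only [a, Sum.elim_inl, Sum.elim_inr] <;> split_ifs <;> norm_num
  have ha' : ∀ k, ∃ i, 0 < a k i := by
    rintro (j | h)
    · exact ⟨j, by simp [a]⟩
    · obtain ⟨i, hi⟩ := hinc h
      exact ⟨i, by simp [a, hi]⟩
  have hbot : ∀ i e, c i (Sum.inl i) ≤ c i e := by
    rintro i e
    by_cases h : rank i e = 0
    · have : e = Sum.inl i := by
        rcases e with j | h'
        · simp only [rank, Sum.elim_inl] at h
          split_ifs at h with hji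
          · rw [hji]
        · simp only [rank, Sum.elim_inr] at h
          split_ifs at h
      rw [this]
    · exact (hlt _ _ _ (by simpa [rank] using Nat.pos_of_ne_zero h)).le
  have htop : ∀ i j e, i ≠ j → e ∉ Set.range (Sum.inl : ι → ι ⊕ H) →
      c i e < c i (Sum.inl j) := by
    rintro i j (k | h) hij he
    · exact absurd ⟨k, rfl⟩ he
    · refine hlt _ _ _ ?_
      simp only [rank, Sum.elim_inr, Sum.elim_inl, if_neg hij.symm]
      split_ifs <;> norm_num
  obtain ⟨β, hβ⟩ := exists_direction_eventually_generic a (1 : ι → ℚ)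
  have hpos : ∀ᶠ ε in 𝓝[>] (0 : ℚ), ∀ i, 0 ≤ ((1 : ι → ℚ) + ε • β) i := by
    rw [eventually_all]
    intro i
    have h0 : Tendsto (fun ε : ℚ => 1 + ε * β i) (𝓝 0) (𝓝 1) := by
      have : Continuous fun ε : ℚ => 1 + ε * β i := by fun_prop
      simpa using this.tendsto 0
    filter_upwards [nhdsWithin_le_nhds (h0.eventually_const_lt zero_lt_one)] with ε hε
    simpa using hε.le
  obtain ⟨D, hDcard, hDdom, x, hx0, hxD, hx⟩ : ∃ D : Finset (ι ⊕ H), #D = Fintype.card ι ∧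
      IsDominating c D ∧ IsFeasibleOn a 1 D := by
    by_contra! hno
    have hev : ∀ D : Finset (ι ⊕ H), ∀ᶠ ε in 𝓝[>] (0 : ℚ),
        ¬ (#D = Fintype.card ι ∧ IsDominating c D ∧
          IsGenericFor a ((1 : ι → ℚ) + ε • β) ∧ IsFeasibleOn a ((1 : ι → ℚ) + ε • β) D) := by
      intro D
      by_cases h : #D = Fintype.card ι ∧ IsDominating c D
      · have h1 : ¬ _ := mt (isFeasibleOn_of_frequently (β := β) h.1) (hno D h.1 h.2)
        filter_upwards [not_frequently.1 h1] with ε hε hε'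
        exact hε hε'.2.2
      · exact Eventually.of_forall fun ε hε => h ⟨hε.1, hε.2.1⟩
    obtain ⟨ε, hε, hg, hp⟩ := ((eventually_all.2 hev).and (hβ.and hpos)).exists
    obtain ⟨D, h1, h2, h3⟩ := exists_dominating_feasible hc Sum.inl_injective hbot htop ha ha'
      (fun i v => by simp [a]) hp hg
    exact hε D ⟨h1, h2, hg, h3⟩
  have hsum : ∀ i, x (Sum.inl i) + ∑ h with inc i h, x (Sum.inr h) = 1 := by
    intro i
    have := congrFun hx i
    simpa [Fintype.sum_sum_type, a, sum_filter] using this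
  refine ⟨fun h => x (Sum.inr h), fun h => hx0 _, fun i => ?_, fun e => ?_⟩
  · linarith [hsum i, hx0 (Sum.inl i)]
  obtain ⟨i, hi⟩ := hDdom (Sum.inr e)
  have hslack : x (Sum.inl i) = 0 := hxD _ fun hmem => by
    have h1 := hle _ _ _ (hi _ hmem)
    simp only [rank, Sum.elim_inl, Sum.elim_inr, if_true] at h1
    split_ifs at h1 <;> simp at h1
  have htight : ∑ h with inc i h, x (Sum.inr h) = 1 := by linarith [hsum i]
  have hrank : ∀ h, inc i h → 0 < x (Sum.inr h) → inc i e ∧ pref i e ≤ pref i h := by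
    intro h hih hxh
    have hmem : Sum.inr h ∈ D := by
      by_contra hD
      exact hxh.ne' (hxD _ hD)
    have h1 := hle _ _ _ (hi _ hmem)
    simp only [rank, score, Sum.elim_inr, if_pos hih] at h1
    by_cases hie : inc i e
    · simp only [if_pos hie, lt_irrefl, true_and, false_or] at h1
      exact ⟨hie, h1⟩
    · simp only [if_neg hie] at h1
      omega
  obtain ⟨h, hih, hxh⟩ : ∃ h, inc i h ∧ 0 < x (Sum.inr h) := by
    by_contra! hno
    have : ∑ h with inc i h, x (Sum.inr h) ≤ 0 :=
      sum_nonpos fun h hh => hno h (mem_filter.1 hh).2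
    linarith
  exact ⟨i, (hrank h hih hxh).1, htight, fun h' h1 h2 => (hrank h' h1 h2).2⟩

/-- A relation between rows and columns is balanced if it contains no cycle of odd length in which
each row of the cycle meets exactly two of its columns. -/
def IsBalancedRel {ι J : Type*} (inc : ι → J → Prop) : Prop :=
  ∀ (k : ℕ) (r : ZMod k → ι) (col : ZMod k → J), Odd k → 3 ≤ k → Function.Injective r →
    Function.Injective col → ¬ ∀ t i, inc (r t) (col i) ↔ i = t ∨ i = t + 1

theorem ZMod.two_ne_zero_of_three_le {k : ℕ} (h3 : 3 ≤ k) : (2 : ZMod k) ≠ 0 := by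
  intro h
  have : ((2 : ℕ) : ZMod k) = 0 := by exact_mod_cast h
  have := Nat.le_of_dvd two_pos ((ZMod.natCast_eq_zero_iff 2 k).1 this)
  omega

theorem ZMod.eq_of_forall_consecutive {k : ℕ} (h3 : 3 ≤ k) {t t' : ZMod k}
    (h : ∀ i : ZMod k, i = t ∨ i = t + 1 ↔ i = t' ∨ i = t' + 1) : t = t' := by
  rcases (h t).1 (Or.inl rfl) with h1 | h1
  · exact h1
  rcases (h t').2 (Or.inl rfl) with h2 | h2
  · exact h2.symm
  refine absurd ?_ (ZMod.two_ne_zero_of_three_le h3)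
  have : t + 2 = t := by nth_rw 2 [h1]; rw [h2]; ring
  simpa using this

/-- A path `u 0, …, u m` with a chord from `u 0` to both ends of an odd-length segment
`u a, …, u b` contains an odd cycle; here edges are rows with exactly two columns in `S`. -/
theorem not_isBalancedRel_of_path {ι J : Type*} [DecidableEq J] {inc : ι → J → Prop}
    {S : Finset J} {u : ℕ → J} {a b : ℕ} (ha : 0 < a) (hab : a < b) (hodd : Odd (b - a))
    (huS : ∀ i ≤ b, u i ∈ S) (hu : ∀ i ≤ b, ∀ j ≤ b, u i = u j → i = j)
    (hadj : ∀ i < b, ∃ r, ∀ j ∈ S, inc r j ↔ j = u i ∨ j = u (i + 1))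
    (h0a : ∃ r, ∀ j ∈ S, inc r j ↔ j = u 0 ∨ j = u a)
    (h0b : ∃ r, ∀ j ∈ S, inc r j ↔ j = u 0 ∨ j = u b) : ¬ IsBalancedRel inc := by
  intro hbal
  obtain ⟨l, hl⟩ := hodd
  obtain ⟨n, hn⟩ : ∃ n, n = b - a + 1 := ⟨_, rfl⟩
  let pos : ℕ → ℕ := fun t => if t = 0 then 0 else a + t - 1
  have hposb : ∀ t : Fin (n + 1), pos t ≤ b := fun t => by
    have := t.2
    simp only [pos]; split_ifs <;> omega
  let col : ZMod (n + 1) → J := fun t => u (pos (Fin.val (n := n + 1) t))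
  have hcolinj : Function.Injective col := fun t t' h => by
    have h1 := hu _ (hposb t) _ (hposb t') h
    refine Fin.ext (n := n + 1) ?_
    simp only [pos] at h1
    split_ifs at h1 <;> omega
  have hcolS : ∀ t, col t ∈ S := fun t => huS _ (hposb t)
  have hsucc : ∀ s : Fin (n + 1), (s + 1).val = if s.val = n then 0 else s.val + 1 := fun s => by
    rw [Fin.val_add_one]
    simp only [Fin.ext_iff, Fin.val_last]
  have hrow : ∀ t, ∃ r, ∀ j ∈ S, inc r j ↔ j = col t ∨ j = col (t + 1) := by
    intro t
    have hlt := Fin.is_lt (n := n + 1) t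
    have hval : Fin.val (n := n + 1) (t + 1 : ZMod (n + 1)) = if Fin.val (n := n + 1) t = n then 0 else
        Fin.val (n := n + 1) t + 1 := hsucc t
    change ∃ r, ∀ j ∈ S, inc r j ↔ j = u (pos (Fin.val (n := n + 1) t)) ∨
      j = u (pos (Fin.val (n := n + 1) (t + 1 : ZMod (n + 1))))
    rw [hval]
    generalize Fin.val (n := n + 1) t = v at hlt
    by_cases hv0 : v = 0
    · subst hv0
      rw [if_neg (by omega)]
      simpa [pos] using h0a
    by_cases hvn : v = n
    · have : pos v = b := by simp only [pos, if_neg hv0]; omega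
      rw [if_pos hvn, this]
      obtain ⟨r, hr⟩ := h0b
      exact ⟨r, fun j hj => (hr j hj).trans or_comm⟩
    · have h1 : pos (v + 1) = pos v + 1 := by simp only [pos, if_neg hv0]; simp; omega
      rw [if_neg hvn, h1]
      exact hadj _ (by simp only [pos, if_neg hv0]; omega)
  choose r hr using hrow
  have hinc : ∀ t i, inc (r t) (col i) ↔ i = t ∨ i = t + 1 := fun t i => by
    rw [hr t _ (hcolS i), hcolinj.eq_iff, hcolinj.eq_iff]
  have hodd : Odd (n + 1) := ⟨l + 1, by omega⟩
  refine hbal (n + 1) r col hodd (by omega) (fun t t' h => ?_) hcolinj hinc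
  exact ZMod.eq_of_forall_consecutive (by omega) fun i => by
    rw [← hinc, ← hinc, h]

/-- Berge: the columns of a balanced relation can be coloured with two colours so that no row with
at least two columns is monochromatic. -/
theorem IsBalancedRel.exists_bicoloring {ι J : Type*} [Fintype J] [DecidableEq J]
    {inc : ι → J → Prop} (hbal : IsBalancedRel inc) (S : Finset J) :
    ∃ f : J → Bool, ∀ i, ∀ j ∈ S, ∀ j' ∈ S, j ≠ j' → inc i j → inc i j' →
      ∃ l ∈ S, ∃ l' ∈ S, inc i l ∧ inc i l' ∧ f l ≠ f l' := by
  classical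
  induction S using Finset.strongInduction with
  | H S ih =>
  by_contra! hbad
  have hSne : S.Nonempty := by
    obtain ⟨i, j, hj, -⟩ := hbad fun _ => true
    exact ⟨j, hj⟩
  -- bicolour `S` without `v`; each way of colouring `v` is obstructed by a row of size two
  have hext : ∀ v ∈ S, ∃ f : J → Bool,
      (∀ i, ∀ j ∈ S.erase v, ∀ j' ∈ S.erase v, j ≠ j' → inc i j → inc i j' →
        ∃ l ∈ S.erase v, ∃ l' ∈ S.erase v, inc i l ∧ inc i l' ∧ f l ≠ f l') ∧
      ∀ β : Bool, ∃ w ∈ S, w ≠ v ∧ f w = β ∧ ∃ r, ∀ j ∈ S, inc r j ↔ j = v ∨ j = w := by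
    intro v hv
    obtain ⟨f, hf⟩ := ih _ (erase_ssubset hv)
    refine ⟨f, hf, fun β => ?_⟩
    obtain ⟨i, j, hj, j', hj', hjj', hij, hij', hmono⟩ := hbad (Function.update f v β)
    have hsame : ∀ k ∈ S.erase v, ∀ k' ∈ S.erase v, inc i k → inc i k' → k = k' := by
      intro k hk k' hk' hik hik'
      by_contra hkk'
      obtain ⟨l, hl, l', hl', hil, hil', hne⟩ := hf i k hk k' hk' hkk' hik hik'
      have := hmono l (mem_of_mem_erase hl) l' (mem_of_mem_erase hl') hil hil'
      rw [Function.update_of_ne (ne_of_mem_erase hl), Function.update_of_ne (ne_of_mem_erase hl')]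
        at this
      exact hne this
    have hiv : inc i v := by
      by_contra hiv
      have hjv : j ≠ v := fun h => hiv (h ▸ hij)
      have hj'v : j' ≠ v := fun h => hiv (h ▸ hij')
      exact hjj' (hsame j (mem_erase.2 ⟨hjv, hj⟩) j' (mem_erase.2 ⟨hj'v, hj'⟩) hij hij')
    obtain ⟨w, hwS, hwv, hiw⟩ : ∃ w ∈ S, w ≠ v ∧ inc i w := by
      by_cases hjv : j = v
      · exact ⟨j', hj', fun h => hjj' (hjv.trans h.symm), hij'⟩
      · exact ⟨j, hj, hjv, hij⟩
    refine ⟨w, hwS, hwv, ?_, i, fun k hk => ⟨fun hik => ?_, ?_⟩⟩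
    · have := hmono w hwS v hv hiw hiv
      rwa [Function.update_of_ne hwv, Function.update_self] at this
    · by_cases hkv : k = v
      · exact Or.inl hkv
      · exact Or.inr (hsame k (mem_erase.2 ⟨hkv, hk⟩) w (mem_erase.2 ⟨hwv, hwS⟩) hik hiw)
    · rintro (rfl | rfl)
      · exact hiv
      · exact hiw
  let IsPath : ℕ → (ℕ → J) → Prop := fun m u =>
    (∀ i ≤ m, u i ∈ S) ∧ (∀ i ≤ m, ∀ j ≤ m, u i = u j → i = j) ∧
      ∀ i < m, ∃ r, ∀ j ∈ S, inc r j ↔ j = u i ∨ j = u (i + 1)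
  have hbound : ∀ m u, IsPath m u → m ≤ #S := by
    rintro m u ⟨h1, h2, -⟩
    have : #((range (m + 1)).image u) ≤ #S := card_le_card fun j hj => by
      obtain ⟨i, hi, rfl⟩ := mem_image.1 hj
      exact h1 i (by simpa [Nat.lt_succ_iff] using hi)
    rw [card_image_of_injOn, card_range] at this
    · omega
    · intro i hi j hj hij
      exact h2 i (by simpa [Nat.lt_succ_iff] using hi) j (by simpa [Nat.lt_succ_iff] using hj) hij
  have hex : ∃ m, ∃ u, IsPath m u := by
    obtain ⟨v, hv⟩ := hSne
    exact ⟨0, fun _ => v, fun _ _ => hv, by omega, by omega⟩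
  obtain ⟨m, ⟨u, huS, hu, hadj⟩, hmax⟩ : ∃ m, (∃ u, IsPath m u) ∧ ∀ m', (∃ u, IsPath m' u) → m' ≤ m := by
    obtain ⟨m₀, hm₀⟩ := hex
    refine ⟨Nat.findGreatest (fun m => ∃ u, IsPath m u) #S,
      Nat.findGreatest_spec (P := fun m => ∃ u, IsPath m u) (hbound _ _ hm₀.choose_spec) hm₀,
      fun m' hm' => Nat.le_findGreatest (hbound _ _ hm'.choose_spec) hm'⟩
  obtain ⟨f, hf, hnb⟩ := hext (u 0) (huS 0 (Nat.zero_le _))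
  -- by maximality, the neighbours of the end of the path lie on the path
  have hon : ∀ w ∈ S, w ≠ u 0 → (∃ r, ∀ j ∈ S, inc r j ↔ j = u 0 ∨ j = w) →
      ∃ a, 0 < a ∧ a ≤ m ∧ u a = w := by
    rintro w hwS hw0 ⟨r, hr⟩
    by_contra! hnot
    have hnot' : ∀ i ≤ m, u i ≠ w := fun i hi => by
      rcases Nat.eq_zero_or_pos i with rfl | hpos
      · exact hw0.symm
      · exact hnot i hpos hi
    have := hmax (m + 1) ⟨fun i => Nat.casesOn i w u, ?_, ?_, ?_⟩
    · omega
    · rintro (_ | i) hi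
      · exact hwS
      · exact huS i (by omega)
    · rintro (_ | i) hi (_ | j) hj hij
      · rfl
      · exact absurd hij.symm (hnot' j (by omega))
      · exact absurd hij (hnot' i (by omega))
      · rw [hu i (by omega) j (by omega) hij]
    · rintro (_ | i) hi
      · exact ⟨r, fun j hj => (hr j hj).trans or_comm⟩
      · exact hadj i (by omega)
  obtain ⟨w, hwS, hw0, hfw, hrw⟩ := hnb true
  obtain ⟨w', hwS', hw0', hfw', hrw'⟩ := hnb false
  obtain ⟨a, ha0, ham, rfl⟩ := hon w hwS hw0 hrw
  obtain ⟨b, hb0, hbm, rfl⟩ := hon w' hwS' hw0' hrw'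
  have hflip : ∀ i, 0 < i → i < m → f (u (i + 1)) = !f (u i) := by
    intro i hi him
    obtain ⟨r, hr⟩ := hadj i him
    have hmem : ∀ j, 0 < j → j ≤ m → u j ∈ S.erase (u 0) := fun j hj hjm =>
      mem_erase.2 ⟨fun h => hj.ne' (hu j hjm 0 (Nat.zero_le _) h), huS j hjm⟩
    obtain ⟨l, hl, l', hl', hrl, hrl', hne⟩ := hf r (u i) (hmem i hi him.le) (u (i + 1))
      (hmem _ (by omega) (by omega))
      (fun h => by have := hu i him.le (i + 1) him h; omega)
      ((hr _ (huS i him.le)).2 (Or.inl rfl)) ((hr _ (huS _ him)).2 (Or.inr rfl))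
    rcases (hr l (mem_of_mem_erase hl)).1 hrl with rfl | rfl <;>
      rcases (hr l' (mem_of_mem_erase hl')).1 hrl' with rfl | rfl <;>
      revert hne <;> cases f (u i) <;> cases f (u (i + 1)) <;> simp
  have hparity : ∀ i, 0 < i → ∀ d, i + d ≤ m → f (u (i + d)) = xor (f (u i)) (decide (Odd d)) := by
    intro i hi d
    induction d with
    | zero => intro _; simp
    | succ d ihd =>
      intro hd
      rw [← add_assoc, hflip (i + d) (by omega) (by omega), ihd (by omega)]
      by_cases hod : Odd d
      · have : ¬ Odd (d + 1) := by rw [Nat.odd_add_one]; simpa using hod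
        simp [hod, this]
      · have : Odd (d + 1) := by rwa [Nat.odd_add_one]
        simp [hod, this]
  have hkey : ∀ i j, 0 < i → i < j → j ≤ m → f (u i) ≠ f (u j) →
      (∃ r, ∀ l ∈ S, inc r l ↔ l = u 0 ∨ l = u i) →
      (∃ r, ∀ l ∈ S, inc r l ↔ l = u 0 ∨ l = u j) → False := by
    intro i j hi hij hjm hne h1 h2
    have hodd : Odd (j - i) := by
      by_contra hno
      have := hparity i hi (j - i) (by omega)
      rw [Nat.add_sub_cancel' hij.le] at this
      simp [hno] at this
      exact hne this.symm
    exact not_isBalancedRel_of_path hi hij hodd (fun l hl => huS l (by omega))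
      (fun l hl l' hl' => hu l (by omega) l' (by omega)) (fun l hl => hadj l (by omega)) h1 h2 hbal
  rcases lt_trichotomy a b with h | h | h
  · exact hkey a b ha0 h hbm (by simp [hfw, hfw']) hrw hrw'
  · subst h
    simp [hfw] at hfw'
  · exact hkey b a hb0 h ham (by simp [hfw, hfw']) hrw' hrw

/-- Berge: if every row of a balanced relation has at most `k` columns, the columns can be coloured
with `k` colours so that columns sharing a row have different colours. -/
theorem IsBalancedRel.exists_coloring {ι J : Type*} [Fintype ι] [Fintype J]
    {inc : ι → J → Prop} [∀ i, DecidablePred (inc i)] (hbal : IsBalancedRel inc) {k : ℕ}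
    (hk : 0 < k) (hdeg : ∀ i, #{j | inc i j} ≤ k) :
    ∃ col : J → Fin k, ∀ i j j', inc i j → inc i j' → col j = col j' → j = j' := by
  classical
  have : Nonempty (Fin k) := ⟨⟨0, hk⟩⟩
  let N : ι → Finset J := fun i => univ.filter (inc i)
  have hN : ∀ i j, j ∈ N i ↔ inc i j := fun i j => by simp [N]
  obtain ⟨col, -, hmax⟩ := exists_max_image (univ : Finset (J → Fin k))
    (fun col => ∑ i, #((N i).image col)) univ_nonempty
  refine ⟨col, fun i j j' hij hij' hcol => ?_⟩
  by_contra hjj'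
  set p := col j with hp
  obtain ⟨q, hq⟩ : ∃ q, q ∉ (N i).image col := by
    by_contra! hall
    have h1 : #((N i).image col) = k := by
      rw [eq_univ_of_forall hall, card_univ, Fintype.card_fin]
    have h2 : #((N i).image col) = #(N i) := le_antisymm card_image_le (by rw [h1]; exact hdeg i)
    exact hjj' (card_image_iff.1 h2 ((hN i j).2 hij) ((hN i j').2 hij') hcol)
  have hpq : p ≠ q := fun h => hq (h ▸ mem_image_of_mem col ((hN i j).2 hij))
  obtain ⟨f, hf⟩ := hbal.exists_bicoloring {j | col j = p ∨ col j = q}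
  let col' : J → Fin k := fun j => if col j = p ∨ col j = q then (if f j then p else q) else col j
  have hcol'1 : ∀ j, ¬ (col j = p ∨ col j = q) → col' j = col j := fun j hj => if_neg hj
  have hcol'2 : ∀ j, col j = p ∨ col j = q → col' j = p ∨ col' j = q := fun j hj => by
    simp only [col', if_pos hj]
    split_ifs <;> simp
  have htwo : ∀ r l l', inc r l → inc r l' → l ≠ l' → (col l = p ∨ col l = q) →
      (col l' = p ∨ col l' = q) →
      insert q (insert p ((N r).image col)) ⊆ (N r).image col' := by
    intro r l l' hl hl' hne hlc hlc'
    obtain ⟨x, hx, y, hy, hrx, hry, hxy⟩ :=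
      hf r l (by simpa using hlc) l' (by simpa using hlc') hne hl hl'
    replace hx : col x = p ∨ col x = q := by simpa using hx
    replace hy : col y = p ∨ col y = q := by simpa using hy
    have hpq_mem : p ∈ (N r).image col' ∧ q ∈ (N r).image col' := by
      have hx' : col' x ∈ (N r).image col' := mem_image_of_mem _ ((hN r x).2 hrx)
      have hy' : col' y ∈ (N r).image col' := mem_image_of_mem _ ((hN r y).2 hry)
      simp only [col', if_pos hx] at hx'
      simp only [col', if_pos hy] at hy'
      cases hfx : f x <;> cases hfy : f y
      · exact absurd (hfx.trans hfy.symm) hxy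
      · exact ⟨by simpa only [hfy, if_true] using hy',
          by simpa only [hfx, Bool.false_eq_true, if_false] using hx'⟩
      · exact ⟨by simpa only [hfx, if_true] using hx',
          by simpa only [hfy, Bool.false_eq_true, if_false] using hy'⟩
      · exact absurd (hfx.trans hfy.symm) hxy
    intro z hz
    rcases mem_insert.1 hz with rfl | hz
    · exact hpq_mem.2
    rcases mem_insert.1 hz with rfl | hz
    · exact hpq_mem.1
    obtain ⟨y, hy, rfl⟩ := mem_image.1 hz
    by_cases hyc : col y = p ∨ col y = q
    · rcases hyc with h | h
      · rw [h]; exact hpq_mem.1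
      · rw [h]; exact hpq_mem.2
    · rw [← hcol'1 y hyc]
      exact mem_image_of_mem _ hy
  have hle : ∀ r, #((N r).image col) ≤ #((N r).image col') := by
    intro r
    by_cases h2 : ∃ l l', inc r l ∧ inc r l' ∧ l ≠ l' ∧ (col l = p ∨ col l = q) ∧
        (col l' = p ∨ col l' = q)
    · obtain ⟨l, l', h1, h2, h3, h4, h5⟩ := h2
      exact card_le_card (((subset_insert _ _).trans (subset_insert _ _)).trans
        (htwo r l l' h1 h2 h3 h4 h5))
    push Not at h2
    by_cases hch : ∃ l, inc r l ∧ col' l ≠ col l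
    · obtain ⟨l, hl, hne⟩ := hch
      have hlc : col l = p ∨ col l = q := by
        by_contra h
        exact hne (hcol'1 l h)
      have hswap : (N r).image col' = ((N r).image col).image (Equiv.swap p q) := by
        rw [image_image]
        refine image_congr fun y hy => ?_
        replace hy : inc r y := (hN r y).1 hy
        simp only [Function.comp_apply]
        by_cases hyl : y = l
        · subst hyl
          have h0 := hcol'2 y hlc
          rcases hlc with h | h <;> rcases h0 with h' | h'
          · exact absurd (h'.trans h.symm) hne
          · rw [h, h', Equiv.swap_apply_left]
          · rw [h, h', Equiv.swap_apply_right]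
          · exact absurd (h'.trans h.symm) hne
        · have hyp : ¬ (col y = p ∨ col y = q) := by
            have := h2 l y hl hy (Ne.symm hyl) hlc
            tauto
          rw [hcol'1 y hyp, Equiv.swap_apply_of_ne_of_ne (fun h => hyp (Or.inl h))
            (fun h => hyp (Or.inr h))]
      rw [hswap, card_image_of_injective _ (Equiv.swap p q).injective]
    · push Not at hch
      refine le_of_eq (congrArg card (image_congr fun y hy => ?_))
      exact (hch y ((hN r y).1 hy)).symm
  have hlt : #((N i).image col) < #((N i).image col') := by
    refine card_lt_card ⟨?_, ?_⟩
    · exact ((subset_insert _ _).trans (subset_insert _ _)).trans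
        (htwo i j j' hij hij' hjj' (Or.inl rfl) (Or.inl hcol.symm))
    · intro hsub
      exact hq (hsub (htwo i j j' hij hij' hjj' (Or.inl rfl) (Or.inl hcol.symm)
        (mem_insert_self _ _)))
  exact absurd (hmax col' (mem_univ _))
    (not_le.2 (sum_lt_sum (fun r _ => hle r) ⟨i, mem_univ i, hlt⟩))

/-- A rational fractional matching with balanced support can be rounded to a matching in the
support that still covers all saturated vertices. -/
theorem exists_matching_of_fractional {ι H : Type*} [Fintype ι] [Fintype H]
    {inc : ι → H → Prop} [∀ i, DecidablePred (inc i)] {x : H → ℚ}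
    (hx0 : ∀ h, 0 ≤ x h) (hx1 : ∀ i, ∑ h with inc i h, x h ≤ 1)
    (hbal : IsBalancedRel fun i (h : {h : H // 0 < x h}) => inc i h) :
    ∃ P : Set H, (∀ h ∈ P, 0 < x h) ∧ (∀ i, ∀ h ∈ P, ∀ h' ∈ P, inc i h → inc i h' → h = h') ∧
      ∀ i, ∑ h with inc i h, x h = 1 → ∃ h ∈ P, inc i h := by
  classical
  obtain ⟨k, hk, y, hy⟩ : ∃ k : ℕ, 0 < k ∧ ∃ y : H → ℕ, ∀ h, (y h : ℚ) = k * x h := by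
    refine ⟨∏ h, (x h).den, prod_pos fun h _ => (x h).den_pos,
      fun h => (∏ l ∈ univ.erase h, (x l).den) * (x h).num.toNat, fun h => ?_⟩
    have h1 : ((x h).num.toNat : ℚ) = (x h).den * x h := by
      have h2 : (((x h).num.toNat : ℤ) : ℚ) = (x h).num := by
        rw [Int.toNat_of_nonneg (Rat.num_nonneg.2 (hx0 h))]
      rw [mul_comm, Rat.mul_den_eq_num, ← h2]; norm_cast
    rw [← mul_prod_erase univ (fun h => (x h).den) (mem_univ h)]
    push_cast
    rw [h1]; ring
  have hkQ : (0 : ℚ) < k := by exact_mod_cast hk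
  let J := Σ h : H, Fin (y h)
  have hypos : ∀ j : J, 0 < x j.1 := fun j => by
    have h1 : 0 < y j.1 := (Nat.zero_le _).trans_lt j.2.2
    have h2 : (0 : ℚ) < k * x j.1 := by rw [← hy]; exact_mod_cast h1
    exact pos_of_mul_pos_right h2 hkQ.le
  let incJ : ι → J → Prop := fun i j => inc i j.1
  have hdeg : ∀ i, (#{j | incJ i j} : ℚ) = k * ∑ h with inc i h, x h := by
    intro i
    have h1 : #{j | incJ i j} = ∑ h with inc i h, y h := by
      have : univ.filter (incJ i) = (univ.filter (inc i)).sigma fun h => (univ : Finset (Fin (y h))) := by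
        ext j
        rw [mem_filter]
        exact ⟨fun h => mem_sigma.2 ⟨by simpa using h.2, mem_univ _⟩,
          fun h => ⟨mem_univ _, by simpa using (mem_sigma.1 h).1⟩⟩
      rw [this, card_sigma]; simp
    rw [h1, mul_sum]
    push_cast
    exact sum_congr rfl fun h _ => hy h
  have hbalJ : IsBalancedRel incJ := by
    intro n r col hodd h3 hr hcol hcyc
    refine hbal n r (fun t => ⟨(col t).1, hypos _⟩) hodd h3 hr (fun t t' h => ?_) hcyc
    have h' : (col t).1 = (col t').1 := congrArg Subtype.val h
    have hstep : ∀ i, t = i ∨ t = i + 1 ↔ t' = i ∨ t' = i + 1 := fun i => by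
      rw [← hcyc, ← hcyc]; simp only [incJ, h']
    have : t - 1 = t' - 1 := ZMod.eq_of_forall_consecutive h3 fun i => by
      have := hstep i
      constructor
      · rintro (hi | hi)
        · rcases this.1 (Or.inr (by rw [hi]; ring)) with h | h
          · exact Or.inr (by rw [h]; ring)
          · exact Or.inl (by rw [h]; ring)
        · rcases this.1 (Or.inl (by rw [hi]; ring)) with h | h
          · exact Or.inr (by rw [h]; ring)
          · exact Or.inl (by rw [h]; ring)
      · rintro (hi | hi)
        · rcases this.2 (Or.inr (by rw [hi]; ring)) with h | h
          · exact Or.inr (by rw [h]; ring)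
          · exact Or.inl (by rw [h]; ring)
        · rcases this.2 (Or.inl (by rw [hi]; ring)) with h | h
          · exact Or.inr (by rw [h]; ring)
          · exact Or.inl (by rw [h]; ring)
    simpa using this
  obtain ⟨col, hcol⟩ := hbalJ.exists_coloring hk (fun i => by
    have h1 : (#{j | incJ i j} : ℚ) ≤ k := by
      rw [hdeg i]
      exact mul_le_of_le_one_right hkQ.le (hx1 i)
    exact_mod_cast h1)
  refine ⟨{h | ∃ j : J, j.1 = h ∧ col j = ⟨0, hk⟩}, ?_, ?_, ?_⟩
  · rintro h ⟨j, rfl, -⟩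
    exact hypos j
  · rintro i h ⟨j, rfl, hj⟩ h' ⟨j', rfl, hj'⟩ hi hi'
    rw [hcol i j j' hi hi' (hj.trans hj'.symm)]
  · intro i hi
    have h1 : #{j | incJ i j} = k := by
      have := hdeg i
      rw [hi, mul_one] at this
      exact_mod_cast this
    have h2 : (univ.filter (incJ i)).image col = univ := by
      rw [← card_eq_iff_eq_univ, card_image_of_injOn, h1, Fintype.card_fin]
      intro j hj j' hj' h
      exact hcol i j j' (by simpa using hj) (by simpa using hj') h
    obtain ⟨j, hj, hj0⟩ := mem_image.1 (h2 ▸ mem_univ (⟨0, hk⟩ : Fin k))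
    exact ⟨j.1, ⟨j, rfl, hj0⟩, by simpa [incJ] using hj⟩

theorem exists_nat_rank_of_isStrictTotalOrder {α : Type*} [Finite α] (r : α → α → Prop)
    [IsStrictTotalOrder α r] : ∃ rank : α → ℕ, ∀ a b, r a b → rank b < rank a :=
  ⟨fun a => {b | r a b}.ncard, fun _ b hab => Set.ncard_lt_ncard
    ⟨fun _ hc => _root_.trans hab hc, fun h => irrefl (r := r) b (h hab)⟩⟩

namespace DMarket

/-- The hyperedge of the firm-worker hypergraph given by a firm and a set of workers. -/
def hyperedge {F W : Type*} [DecidableEq F] [DecidableEq W] (p : F × Finset W) : Finset (F ⊕ W) :=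
  insert (Sum.inl p.1) (p.2.image Sum.inr)

theorem inl_mem_hyperedge {F W : Type*} [DecidableEq F] [DecidableEq W] {p : F × Finset W}
    {f : F} : Sum.inl f ∈ hyperedge p ↔ f = p.1 := by
  simp [hyperedge]

theorem inr_mem_hyperedge {F W : Type*} [DecidableEq F] [DecidableEq W] {p : F × Finset W}
    {w : W} : Sum.inr w ∈ hyperedge p ↔ w ∈ p.2 := by
  simp [hyperedge]

theorem hyperedge_injective {F W : Type*} [DecidableEq F] [DecidableEq W] :
    Function.Injective (hyperedge : F × Finset W → Finset (F ⊕ W)) := by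
  intro p q h
  refine Prod.ext ?_ ?_
  · rw [← inl_mem_hyperedge, ← h, inl_mem_hyperedge]
  · ext w
    rw [← inr_mem_hyperedge, ← inr_mem_hyperedge, h]

variable {F W : Type*} [Fintype W] [DecidableEq F] [DecidableEq W]

theorem pf_asymm (M : DMarket F W) {f : F} {A B : Finset W} (h : M.pf f A B) : ¬ M.pf f B A :=
  haveI := M.pf_sto f
  _root_.asymm h

theorem Ch_Ch (M : DMarket F W) (f : F) (S : Finset W) : M.Ch f (M.Ch f S) = M.Ch f S := by
  by_contra hne
  exact M.pf_asymm (M.Ch_max f _ _ subset_rfl (Ne.symm hne))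
    (M.Ch_max f _ _ ((M.Ch_subset f _).trans (M.Ch_subset f S)) hne)

theorem Ch_empty (M : DMarket F W) (f : F) : M.Ch f ∅ = ∅ :=
  subset_empty.1 (M.Ch_subset f ∅)

theorem satisf_Ch_of_pf (M : DMarket F W) {f : F} {S T : Finset W}
    (h : M.pf f (M.Ch f S) (M.Ch f T)) : M.Satisf f (M.Ch f S) := by
  refine ⟨nonempty_iff_ne_empty.2 fun h0 => ?_, M.Ch_Ch f S⟩
  rw [h0] at h
  by_cases hT : ∅ = M.Ch f T
  · rw [← hT] at h
    exact M.pf_asymm h h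
  · exact M.pf_asymm h (M.Ch_max f T ∅ (empty_subset T) hT)

theorem Ch_pf_of_pf (M : DMarket F W) {f : F} {S T : Finset W} (h : M.pf f S T) :
    M.pf f (M.Ch f S) T := by
  have := M.pf_sto f
  by_cases hS : S = M.Ch f S
  · rwa [← hS]
  · exact _root_.trans (M.Ch_max f S S subset_rfl hS) h

/-- The pairs of a firm `f` and a satisfactory set of `f` whose workers all find `f` acceptable. -/
abbrev AcceptablePair (M : DMarket F W) : Type _ :=
  {p : F × Finset W // M.Satisf p.1 p.2 ∧ ∀ w ∈ p.2, M.pw w (some p.1) none}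

/-- The pair `p` is dominated at a vertex by the set `P` of acceptable pairs: every pair of `P` at
that vertex is at least as good as `p`, where a worker ranks pairs by their firm and breaks ties
according to the preference of that firm. -/
def DominatedAt (M : DMarket F W) (P : Set M.AcceptablePair) (p : F × Finset W) :
    F ⊕ W → Prop
  | Sum.inl f => ∀ q ∈ P, f = q.1.1 → ¬ M.pf f p.2 q.1.2
  | Sum.inr w => ∀ q ∈ P, w ∈ q.1.2 →
      ¬ M.pw w (some p.1) (some q.1.1) ∧ (q.1.1 = p.1 → ¬ M.pf p.1 p.2 q.1.2)

open Classical in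
theorem exists_dominating_fractional_matching [Fintype F] (M : DMarket F W)
    [Fintype M.AcceptablePair] :
    ∃ x : M.AcceptablePair → ℚ, (∀ p, 0 ≤ x p) ∧
      (∀ i, ∑ p with i ∈ hyperedge p.1, x p ≤ 1) ∧
      ∀ e : M.AcceptablePair, ∃ i ∈ hyperedge e.1, ∑ p with i ∈ hyperedge p.1, x p = 1 ∧
        M.DominatedAt {p | 0 < x p} e.1 i := by
  choose frank hfrank using fun f =>
    haveI := M.pf_sto f
    exists_nat_rank_of_isStrictTotalOrder (M.pf f)
  choose wrank hwrank using fun w =>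
    haveI := M.pw_sto w
    exists_nat_rank_of_isStrictTotalOrder (M.pw w)
  let pref : F ⊕ W → M.AcceptablePair → ℕ ×ₗ ℕ := fun i p =>
    Sum.elim (fun _ => toLex (frank p.1.1 p.1.2, 0))
      (fun w => toLex (wrank w (some p.1.1), frank p.1.1 p.1.2)) i
  have : Inhabited (ℕ ×ₗ ℕ) := ⟨toLex (0, 0)⟩
  obtain ⟨x, hx0, hx1, hdom⟩ := _root_.exists_dominating_fractional_matching
    (fun i (p : M.AcceptablePair) => i ∈ hyperedge p.1)
    (fun p => ⟨Sum.inl p.1.1, inl_mem_hyperedge.2 rfl⟩) pref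
  refine ⟨x, hx0, hx1, fun e => ?_⟩
  obtain ⟨i, hi, htight, hle⟩ := hdom e
  refine ⟨i, hi, htight, ?_⟩
  rcases i with f | w
  · rintro q hq rfl hlt
    obtain he : q.1.1 = e.1.1 := inl_mem_hyperedge.1 hi
    have h1 := hle q (inl_mem_hyperedge.2 rfl) hq
    have h2 := hfrank _ _ _ hlt
    rcases Prod.Lex.toLex_le_toLex.1 h1 with h | ⟨h, -⟩
    · rw [he] at h2 h
      exact lt_asymm h h2
    · rw [he] at h2 h
      exact h2.ne' h
  · intro q hq hwq
    have h1 := hle q (inr_mem_hyperedge.2 hwq) hq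
    refine ⟨fun hlt => ?_, fun he hlt => ?_⟩
    · have h2 := hwrank _ _ _ hlt
      rcases Prod.Lex.toLex_le_toLex.1 h1 with h | ⟨h, -⟩
      · exact lt_asymm h h2
      · exact h2.ne' h
    · have h2 := hfrank _ _ _ hlt
      rcases Prod.Lex.toLex_le_toLex.1 h1 with h | ⟨-, h⟩
      · exact h.ne (by rw [he])
      · rw [he] at h
        exact not_lt.2 h h2

theorem Ch_union_of_dominated (M : DMarket F W) {P : Set M.AcceptablePair}
    (hP : ∀ e : M.AcceptablePair, ∃ i ∈ hyperedge e.1, M.DominatedAt P e.1 i)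
    {f : F} {S S' : Finset W} {p q : M.AcceptablePair} (hp : p ∈ P) (hq : q ∈ P)
    (hpS : p.1 = (f, S)) (hqS : q.1 = (f, S')) :
    M.Ch f (S ∪ S') = S ∨ M.Ch f (S ∪ S') = S' := by
  by_contra! hne
  have h1 := M.Ch_max f (S ∪ S') S subset_union_left (Ne.symm hne.1)
  have h2 := M.Ch_max f (S ∪ S') S' subset_union_right (Ne.symm hne.2)
  have hpp := p.2
  have hqq := q.2
  rw [hpS] at hpp
  rw [hqS] at hqq
  have hacc : ∀ w ∈ M.Ch f (S ∪ S'), M.pw w (some f) none := fun w hw => by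
    rcases mem_union.1 (M.Ch_subset _ _ hw) with h | h
    · exact hpp.2 w h
    · exact hqq.2 w h
  have hsat : M.Satisf f (M.Ch f (S ∪ S')) := M.satisf_Ch_of_pf (T := S) (by rwa [hpp.1.2])
  obtain ⟨i, hi, hdom⟩ := hP ⟨(f, M.Ch f (S ∪ S')), hsat, hacc⟩
  rcases i with g | w
  · obtain rfl : g = f := inl_mem_hyperedge.1 hi
    exact hdom p hp (by rw [hpS]) (by rwa [hpS])
  · rcases mem_union.1 (M.Ch_subset _ _ (inr_mem_hyperedge.1 hi)) with h | h
    · exact (hdom p hp (by rwa [hpS])).2 (by rw [hpS]) (by rwa [hpS])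
    · exact (hdom q hq (by rwa [hqS])).2 (by rw [hqS]) (by rwa [hqS])

theorem isBalancedRel_of_dominated (M : DMarket F W)
    (h : ¬ ∃ (k : ℕ) (j : ZMod k → F ⊕ W) (E : ZMod k → Finset (F ⊕ W)),
      IsNontrivialOddCycle M.fwEdges k j E ∧ M.ChPropCycle E)
    {P : Set M.AcceptablePair}
    (hP : ∀ e : M.AcceptablePair, ∃ i ∈ hyperedge e.1, M.DominatedAt P e.1 i) :
    IsBalancedRel fun i (p : P) => i ∈ hyperedge p.1.1 := by
  intro k r col hodd h3 hr hcol hcyc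
  refine h ⟨k, fun t => r (t - 1), fun i => hyperedge (col i).1.1,
    ⟨⟨by omega, fun t t' htt' => ?_, fun i i' hii' => ?_, fun i => ?_, fun i => ?_⟩, hodd,
      fun i t hit => ?_⟩, ?_⟩
  · simpa using hr htt'
  · exact hcol (Subtype.ext (Subtype.ext (hyperedge_injective hii')))
  · exact ⟨_, _, (col i).1.2.1, rfl⟩
  · refine ⟨(hcyc _ _).2 (Or.inr (by ring)), (hcyc _ _).2 (Or.inl (by ring))⟩
  · rcases (hcyc _ _).1 hit with h | h
    · exact Or.inr (by rw [h]; ring)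
    · exact Or.inl (by rw [h]; ring)
  · rintro f S S' ⟨i, hi⟩ ⟨i', hi'⟩
    exact M.Ch_union_of_dominated hP (col i).2 (col i').2
      (hyperedge_injective (a₂ := (f, S)) hi) (hyperedge_injective (a₂ := (f, S')) hi')

theorem exists_assignment_of_disjoint (M : DMarket F W) {P : Set M.AcceptablePair}
    (hdisj : ∀ i, ∀ p ∈ P, ∀ q ∈ P, i ∈ hyperedge p.1 → i ∈ hyperedge q.1 → p = q) :
    ∃ μ : W → Option F, (∀ w f, μ w = some f ↔ ∃ p ∈ P, w ∈ p.1.2 ∧ p.1.1 = f) ∧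
      ∀ p ∈ P, assignedSet μ p.1.1 = p.1.2 := by
  classical
  have hμ : ∀ w, ∃ o : Option F, ∀ f, o = some f ↔ ∃ p ∈ P, w ∈ p.1.2 ∧ p.1.1 = f := by
    intro w
    by_cases hw : ∃ p ∈ P, w ∈ p.1.2
    · obtain ⟨p, hp, hwp⟩ := hw
      refine ⟨some p.1.1, fun f => ⟨fun h => ⟨p, hp, hwp, Option.some.inj h⟩, ?_⟩⟩
      rintro ⟨q, hq, hwq, rfl⟩
      rw [hdisj (Sum.inr w) p hp q hq (inr_mem_hyperedge.2 hwp) (inr_mem_hyperedge.2 hwq)]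
    · refine ⟨none, fun f => ⟨fun h => by simp at h, ?_⟩⟩
      rintro ⟨q, hq, hwq, rfl⟩
      exact absurd ⟨q, hq, hwq⟩ hw
  choose μ hμ using hμ
  refine ⟨μ, hμ, fun p hp => ?_⟩
  ext w
  simp only [assignedSet, mem_filter, mem_univ, true_and, hμ]
  constructor
  · rintro ⟨q, hq, hwq, hqp⟩
    rwa [hdisj (Sum.inl p.1.1) p hp q hq (inl_mem_hyperedge.2 rfl) (inl_mem_hyperedge.2 hqp.symm)]
  · exact fun hw => ⟨p, hp, hw, rfl⟩

theorem exists_stable_of_dominating (M : DMarket F W) {P : Set M.AcceptablePair}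
    (hdisj : ∀ i, ∀ p ∈ P, ∀ q ∈ P, i ∈ hyperedge p.1 → i ∈ hyperedge q.1 → p = q)
    (hP : ∀ e : M.AcceptablePair, ∃ i ∈ hyperedge e.1, (∃ p ∈ P, i ∈ hyperedge p.1) ∧
      M.DominatedAt P e.1 i) : ∃ μ : W → Option F, M.Stable μ := by
  obtain ⟨μ, hμ, hassigned⟩ := M.exists_assignment_of_disjoint hdisj
  have hfirm : ∀ f, M.Ch f (assignedSet μ f) = assignedSet μ f := by
    intro f
    by_cases hf : ∃ p ∈ P, p.1.1 = f
    · obtain ⟨p, hp, rfl⟩ := hf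
      rw [hassigned p hp]
      exact p.2.1.2
    · have : assignedSet μ f = ∅ := by
        refine eq_empty_of_forall_notMem fun w hw => hf ?_
        obtain ⟨p, hp, -, hpf⟩ := (hμ w f).1 (by simpa [assignedSet] using hw)
        exact ⟨p, hp, hpf⟩
      rw [this, M.Ch_empty]
  have hworker : ∀ w f, μ w = some f → M.pw w (some f) none := by
    intro w f hw
    obtain ⟨p, hp, hwp, rfl⟩ := (hμ w f).1 hw
    exact p.2.2 w hwp
  refine ⟨μ, ⟨fun w => ?_, hfirm⟩, ?_⟩
  · rcases ho : μ w with _ | f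
    · exact Or.inl rfl
    · exact Or.inr (hworker w f ho)
  rintro ⟨f, S, hS, hlt⟩
  have hlt' := M.Ch_pf_of_pf hlt
  have hsat : M.Satisf f (M.Ch f S) := M.satisf_Ch_of_pf (T := assignedSet μ f) (by rwa [hfirm])
  have hacc : ∀ w ∈ M.Ch f S, M.pw w (some f) none := by
    intro w hw
    have := M.pw_sto w
    rcases hS w (M.Ch_subset _ _ hw) with h | h
    · exact hworker w f h
    · rcases ho : μ w with _ | g
      · rwa [ho] at h
      · rw [ho] at h
        exact _root_.trans h (hworker w g ho)
  obtain ⟨i, hi, ⟨p, hp, hip⟩, hdom⟩ := hP ⟨(f, M.Ch f S), hsat, hacc⟩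
  rcases i with g | w
  · obtain rfl : g = f := inl_mem_hyperedge.1 hi
    obtain rfl : g = p.1.1 := inl_mem_hyperedge.1 hip
    exact hdom p hp rfl (by rwa [← hassigned p hp])
  · have hwp := inr_mem_hyperedge.1 hip
    obtain ⟨h1, h2⟩ := hdom p hp hwp
    have hw : μ w = some p.1.1 := (hμ w _).2 ⟨p, hp, hwp, rfl⟩
    rcases hS w (M.Ch_subset _ _ (inr_mem_hyperedge.1 hi)) with h | h
    · obtain rfl : p.1.1 = f := Option.some.inj (hw.symm.trans h)
      exact h2 rfl (by rwa [← hassigned p hp])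
    · exact h1 (by rwa [← hw])

end DMarket

/-- A stable matching exists in a discrete many-to-one matching market
if the firm-worker hypergraph has no nontrivial odd-length cycle with the property that,
for each firm `f` and each pair `S, S'` such that both `{f} ∪ S` and `{f} ∪ S'` are edges
of the cycle, `S = Ch f (S ∪ S')` or `S' = Ch f (S ∪ S')`. -/
theorem stmt2 {F W : Type*} [Fintype F] [Fintype W] [DecidableEq F] [DecidableEq W]
    (M : DMarket F W)
    (h : ¬ ∃ (k : ℕ) (j : ZMod k → F ⊕ W) (E : ZMod k → Finset (F ⊕ W)),
      IsNontrivialOddCycle M.fwEdges k j E ∧ M.ChPropCycle E) :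
    ∃ μ : W → Option F, M.Stable μ := by
  classical
  obtain ⟨x, hx0, hx1, hdom⟩ := M.exists_dominating_fractional_matching
  obtain ⟨P, hsupp, hdisj, hcover⟩ := exists_matching_of_fractional hx0 hx1
    (M.isBalancedRel_of_dominated h fun e =>
      let ⟨i, hi, _, hd⟩ := hdom e
      ⟨i, hi, hd⟩)
  refine M.exists_stable_of_dominating hdisj fun e => ?_
  obtain ⟨i, hi, htight, hd⟩ := hdom e
  refine ⟨i, hi, hcover i htight, ?_⟩
  rcases i with f | w
  · exact fun q hq => hd q (hsupp q hq)
  · exact fun q hq => hd q (hsupp q hq)
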